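/- Let a, b ∈ ℝ with 0 < b < 1, 0 < a and a b < 1, and let m, s, v, k ∈ ℂ with Re(m) > −1, Re(v) > 0 and Re(k) > 0. Then ∫₀^b x^m Φ(x, s, v) (−log(a x))^k dx = a^{−1} · Σ_{l=0}^∞ Γ(1+k, −(1 + l + m) log(a b)) / ( a^{l+m} · (1 + l + m)^{k+1} · (l + v)^s ). -/

import Mathlib

open MeasureTheory

/-- Upper incomplete gamma function: `Γ(s, z) = e^{-z} ∫₀^∞ e^{-t} (t + z)^(s-1) dt`,
with principal-branch complex powers. -/
noncomputable def uGamma (s z : ℂ) : ℂ :=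
  Complex.exp (-z) * ∫ t in Set.Ioi (0:ℝ), Complex.exp (-(t:ℂ)) * ((t:ℂ) + z) ^ (s - 1)

/-- Hurwitz–Lerch zeta function `Φ(x, s, v) = Σ_{n=0}^∞ x^n / (n+v)^s`,
with principal-branch complex powers. -/
noncomputable def lerchPhi (x s v : ℂ) : ℂ := ∑' n : ℕ, x ^ n / ((n:ℂ) + v) ^ s

open Set Filter Topology

/-- A locally dominated parametric integral of holomorphic functions is holomorphic. -/
theorem differentiableAt_integral_of_locally_dominated {μ : Measure ℝ} {H : ℂ → ℝ → ℂ} {z : ℂ}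
    {ε : ℝ} (hε : 0 < ε) {bound : ℝ → ℝ}
    (hmeas : ∀ w ∈ Metric.ball z ε, AEStronglyMeasurable (H w) μ)
    (hdiff : ∀ᵐ t ∂μ, DifferentiableOn ℂ (fun w => H w t) (Metric.ball z ε))
    (hbound : ∀ᵐ t ∂μ, ∀ w ∈ Metric.ball z ε, ‖H w t‖ ≤ bound t)
    (hint : Integrable bound μ) :
    DifferentiableAt ℂ (fun w => ∫ t, H w t ∂μ) z := by
  have hz : z ∈ Metric.ball z ε := Metric.mem_ball_self hε
  have hderiv : ∀ᵐ t ∂μ, ∀ w ∈ Metric.ball z ε,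
      HasDerivAt (fun w => H w t) (deriv (fun w => H w t) w) w := by
    filter_upwards [hdiff] with t ht w hw
    exact ((ht w hw).differentiableAt (Metric.isOpen_ball.mem_nhds hw)).hasDerivAt
  have hsub : Metric.ball z (ε / 2) ⊆ Metric.ball z ε := Metric.ball_subset_ball (by linarith)
  have hseq : Tendsto (fun n : ℕ => z + ((ε / 2 * (1 / ((n : ℝ) + 1)) : ℝ) : ℂ)) atTop (𝓝[≠] z) := by
    refine tendsto_nhdsWithin_iff.2 ⟨?_, Eventually.of_forall fun n => ?_⟩
    · have h1 : Tendsto (fun n : ℕ => ε / 2 * (1 / ((n : ℝ) + 1))) atTop (𝓝 (ε / 2 * 0)) :=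
        tendsto_one_div_add_atTop_nhds_zero_nat.const_mul _
      have h2 := ((Complex.continuous_ofReal.tendsto _).comp h1).const_add z
      simpa using h2
    · have : ε / 2 * (1 / ((n : ℝ) + 1)) ≠ 0 := by positivity
      simpa only [mem_compl_iff, mem_singleton_iff, add_eq_left, Complex.ofReal_eq_zero] using this
  have hmem : ∀ n : ℕ, z + ((ε / 2 * (1 / ((n : ℝ) + 1)) : ℝ) : ℂ) ∈ Metric.ball z ε := by
    intro n
    rw [mem_ball_iff_norm, add_sub_cancel_left, Complex.norm_real, Real.norm_of_nonneg (by positivity)]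
    have : 1 / ((n : ℝ) + 1) ≤ 1 := by
      rw [div_le_one (by positivity)]
      linarith [n.cast_nonneg (α := ℝ)]
    nlinarith
  refine (hasDerivAt_integral_of_dominated_loc_of_deriv_le (s := Metric.ball z (ε / 2))
    (F' := fun w t => deriv (fun w => H w t) w) (bound := fun t => bound t / (ε / 4))
    (Metric.ball_mem_nhds z (by linarith)) ?_ ?_ ?_ ?_ ?_ ?_).2.differentiableAt
  · filter_upwards [Metric.ball_mem_nhds z hε] with w hw using hmeas w hw
  · exact hint.mono' (hmeas z hz) (by filter_upwards [hbound] with t ht using ht z hz)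
  · refine aestronglyMeasurable_of_tendsto_ae atTop
      (f := fun (n : ℕ) t => slope (fun w => H w t) z (z + ((ε / 2 * (1 / ((n : ℝ) + 1)) : ℝ) : ℂ)))
      (fun n => ?_) ?_
    · simp only [slope_def_field, div_eq_mul_inv]
      exact AEStronglyMeasurable.mul_const ((hmeas _ (hmem n)).sub (hmeas z hz)) _
    · filter_upwards [hderiv] with t ht
      exact (hasDerivAt_iff_tendsto_slope.1 (ht z hz)).comp hseq
  · filter_upwards [hbound, hdiff] with t ht hd w hw
    have hcb : Metric.closedBall w (ε / 4) ⊆ Metric.ball z ε := by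
      refine Metric.closedBall_subset_ball' ?_
      have := Metric.mem_ball.1 hw
      linarith
    refine Complex.norm_deriv_le_of_forall_mem_sphere_norm_le (by linarith) ?_ ?_
    · exact (hd.mono hcb).diffContOnCl_ball subset_rfl
    · intro y hy
      exact ht y (hcb (Metric.sphere_subset_closedBall hy))
  · exact hint.div_const _
  · filter_upwards [hderiv] with t ht w hw using ht w (hsub hw)

theorem Complex.norm_cpow_le_exp_pi_mul (z w : ℂ) :
    ‖z ^ w‖ ≤ ‖z‖ ^ w.re * Real.exp (Real.pi * |w.im|) := by
  refine (Complex.norm_cpow_le z w).trans ?_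
  rw [div_eq_mul_inv, ← Real.exp_neg]
  gcongr
  calc -(Complex.arg z * w.im) ≤ |Complex.arg z * w.im| := neg_le_abs _
    _ = |Complex.arg z| * |w.im| := abs_mul _ _
    _ ≤ _ := by gcongr; exact Complex.abs_arg_le_pi z

theorem integrableOn_exp_neg_mul_mul_add_rpow {δ D K : ℝ} (hδ : 0 < δ) (hD : 0 < D) (hK : 0 < K) :
    IntegrableOn (fun t : ℝ => Real.exp (-δ * t) * (t + D) ^ K) (Ioi 0) := by
  set η := δ / (2 * K) with hη
  have hη0 : 0 < η := by positivity
  have hi : IntegrableOn (fun t : ℝ => (Real.exp (η * D) / η) ^ K * Real.exp (-(δ / 2) * t)) (Ioi 0) :=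
    (integrableOn_exp_mul_Ioi (by linarith) 0).const_mul _
  refine Integrable.mono' hi ?_ ?_
  · refine ContinuousOn.aestronglyMeasurable ?_ measurableSet_Ioi
    refine ContinuousOn.mul (by fun_prop) (ContinuousOn.rpow_const (by fun_prop) ?_)
    intro t ht
    exact Or.inr hK.le
  · filter_upwards [ae_restrict_mem measurableSet_Ioi] with t ht
    have ht : 0 < t := ht
    rw [Real.norm_of_nonneg (by positivity)]
    have h1 : t + D ≤ Real.exp (η * D) / η * Real.exp (η * t) := by
      rw [div_mul_eq_mul_div, ← Real.exp_add, le_div_iff₀ hη0]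
      have := Real.add_one_le_exp (η * D + η * t)
      nlinarith
    calc Real.exp (-δ * t) * (t + D) ^ K
        ≤ Real.exp (-δ * t) * (Real.exp (η * D) / η * Real.exp (η * t)) ^ K := by gcongr
      _ = (Real.exp (η * D) / η) ^ K * (Real.exp (-δ * t) * Real.exp (η * t * K)) := by
          rw [Real.mul_rpow (by positivity) (by positivity), Real.exp_mul (η * t) K]; ring
      _ = _ := by
          rw [← Real.exp_add]
          congr 2
          rw [hη]; field_simp; ring

theorem continuousOn_exp_neg_mul_mul_add_cpow {q : ℂ} (hq : 0 < q.re) (p k : ℂ) :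
    ContinuousOn (fun t : ℝ => Complex.exp (-p * t) * ((t : ℂ) + q) ^ k) (Ioi 0) := by
  refine ContinuousOn.mul (by fun_prop) (ContinuousOn.cpow_const (by fun_prop) ?_)
  intro t ht
  have ht : 0 < t := ht
  left
  simp only [Complex.add_re, Complex.ofReal_re]
  linarith

theorem norm_exp_neg_mul_mul_add_cpow_le {k : ℂ} (hk : 0 < k.re) (p q : ℂ) {δ D t : ℝ}
    (ht : 0 < t) (hp : δ ≤ p.re) (hq : ‖q‖ ≤ D) :
    ‖Complex.exp (-p * t) * ((t : ℂ) + q) ^ k‖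
      ≤ Real.exp (-δ * t) * (t + D) ^ k.re * Real.exp (Real.pi * |k.im|) := by
  rw [norm_mul, mul_assoc]
  gcongr
  · rw [Complex.norm_exp]
    simp only [Complex.mul_re, Complex.neg_re, Complex.ofReal_re, Complex.ofReal_im, mul_zero,
      sub_zero]
    gcongr
  · refine (Complex.norm_cpow_le_exp_pi_mul _ _).trans ?_
    gcongr
    refine (norm_add_le _ _).trans ?_
    rw [Complex.norm_real, Real.norm_of_nonneg ht.le]
    gcongr

/-- Holomorphy of `∫₀^∞ e^{-p(c) t} (t + q(c))^k dt` in the parameter `c`. -/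
theorem differentiableAt_integral_exp_mul_add_cpow {k : ℂ} (hk : 0 < k.re) {p q : ℂ → ℂ}
    (hp : Differentiable ℂ p) (hq : Differentiable ℂ q) {c : ℂ}
    (hpc : 0 < (p c).re) (hqc : 0 < (q c).re) :
    DifferentiableAt ℂ
      (fun c => ∫ t in Ioi (0 : ℝ), Complex.exp (-p c * t) * ((t : ℂ) + q c) ^ k) c := by
  have h1 : ∀ᶠ w in 𝓝 c, (p c).re / 2 < (p w).re :=
    (Complex.continuous_re.comp hp.continuous).continuousAt.eventually_const_lt (half_lt_self hpc)
  have h2 : ∀ᶠ w in 𝓝 c, 0 < (q w).re :=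
    (Complex.continuous_re.comp hq.continuous).continuousAt.eventually_const_lt hqc
  have h3 : ∀ᶠ w in 𝓝 c, ‖q w‖ < ‖q c‖ + 1 :=
    hq.continuous.norm.continuousAt.eventually_lt_const (lt_add_one _)
  obtain ⟨ε, hε, hball⟩ := Metric.eventually_nhds_iff_ball.1 (h1.and (h2.and h3))
  refine differentiableAt_integral_of_locally_dominated hε
    (bound := fun t => Real.exp (-((p c).re / 2) * t) * (t + (‖q c‖ + 1)) ^ k.re
      * Real.exp (Real.pi * |k.im|)) ?_ ?_ ?_ ?_
  · intro w hw
    exact (continuousOn_exp_neg_mul_mul_add_cpow (hball w hw).2.1 _ _).aestronglyMeasurable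
      measurableSet_Ioi
  · filter_upwards [ae_restrict_mem measurableSet_Ioi] with t ht w hw
    have ht : 0 < t := ht
    have hw2 := (hball w hw).2.1
    refine DifferentiableAt.differentiableWithinAt ?_
    refine DifferentiableAt.mul (by fun_prop) ?_
    refine DifferentiableAt.cpow_const (by fun_prop) ?_
    left
    simp only [Complex.add_re, Complex.ofReal_re]
    linarith
  · filter_upwards [ae_restrict_mem measurableSet_Ioi] with t ht w hw
    obtain ⟨hw1, -, hw3⟩ := hball w hw
    exact norm_exp_neg_mul_mul_add_cpow_le hk _ _ ht hw1.le hw3.le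
  · exact (integrableOn_exp_neg_mul_mul_add_rpow (by linarith) (by positivity) hk).mul_const _

theorem integral_exp_neg_mul_add_cpow_of_pos {r L : ℝ} (hr : 0 < r) (hL : 0 < L) (k : ℂ) :
    ∫ t in Ioi (0 : ℝ), Complex.exp (-(t : ℂ)) * ((t : ℂ) + r * L) ^ k
      = (r : ℂ) ^ (k + 1)
        * ∫ t in Ioi (0 : ℝ), Complex.exp (-(r : ℂ) * t) * ((t : ℂ) + L) ^ k := by
  have h := MeasureTheory.integral_comp_mul_left_Ioi
    (fun t : ℝ => Complex.exp (-(t : ℂ)) * ((t : ℂ) + r * L) ^ k) 0 hr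
  rw [mul_zero, eq_inv_smul_iff₀ (ne_of_gt hr)] at h
  rw [← h, Complex.real_smul, Complex.cpow_add _ _ (by exact_mod_cast hr.ne'), Complex.cpow_one,
    mul_comm _ (r : ℂ), mul_assoc,
    ← integral_const_mul ((r : ℂ) ^ k)]
  congr 1
  refine setIntegral_congr_fun measurableSet_Ioi fun t ht => ?_
  have ht : 0 < t := ht
  have : ((r * t : ℝ) : ℂ) + r * L = (r : ℂ) * ((t + L : ℝ) : ℂ) := by push_cast; ring
  simp only [this]
  rw [Complex.mul_cpow_ofReal_nonneg hr.le (by positivity)]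
  push_cast
  ring_nf

/-- Rotation of the ray of integration. -/
theorem integral_exp_neg_mul_add_cpow {L : ℝ} (hL : 0 < L) {k : ℂ} (hk : 0 < k.re) {c : ℂ}
    (hc : 0 < c.re) :
    ∫ t in Ioi (0 : ℝ), Complex.exp (-(t : ℂ)) * ((t : ℂ) + c * L) ^ k
      = c ^ (k + 1) * ∫ t in Ioi (0 : ℝ), Complex.exp (-c * t) * ((t : ℂ) + L) ^ k := by
  have hopen : IsOpen {c : ℂ | 0 < c.re} := isOpen_lt continuous_const Complex.continuous_re
  have hF : AnalyticOnNhd ℂ (fun c : ℂ =>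
      ∫ t in Ioi (0 : ℝ), Complex.exp (-(t : ℂ)) * ((t : ℂ) + c * L) ^ k) {c : ℂ | 0 < c.re} := by
    refine DifferentiableOn.analyticOnNhd (fun w hw => ?_) hopen
    have hw : 0 < w.re := hw
    have := differentiableAt_integral_exp_mul_add_cpow hk (p := fun _ => 1) (q := fun c => c * L)
      (by fun_prop) (by fun_prop) (c := w) (by simp) (by simpa using mul_pos hw hL)
    simp only [neg_mul, one_mul] at this
    exact this.differentiableWithinAt
  have hG : AnalyticOnNhd ℂ (fun c : ℂ =>
      c ^ (k + 1) * ∫ t in Ioi (0 : ℝ), Complex.exp (-c * t) * ((t : ℂ) + L) ^ k)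
      {c : ℂ | 0 < c.re} := by
    refine DifferentiableOn.analyticOnNhd (fun w hw => ?_) hopen
    have hw : 0 < w.re := hw
    refine DifferentiableAt.differentiableWithinAt (DifferentiableAt.mul ?_ ?_)
    · exact differentiableAt_id.cpow_const (Or.inl hw)
    · exact differentiableAt_integral_exp_mul_add_cpow hk (p := fun c => c) (q := fun _ => (L : ℂ))
        (by fun_prop) (by fun_prop) (c := w) hw (by simpa using hL)
  have hconv : IsPreconnected {c : ℂ | 0 < c.re} := (convex_halfSpace_re_gt 0).isPreconnected
  refine hF.eqOn_of_preconnected_of_frequently_eq hG hconv (z₀ := 1) (by simp) ?_ hc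
  have hseq : Tendsto (fun n : ℕ => (((1 : ℝ) + 1 / ((n : ℝ) + 1) : ℝ) : ℂ)) atTop (𝓝[≠] 1) := by
    refine tendsto_nhdsWithin_iff.2 ⟨?_, Eventually.of_forall fun n => ?_⟩
    · have h1 : Tendsto (fun n : ℕ => (1 : ℝ) + 1 / ((n : ℝ) + 1)) atTop (𝓝 (1 + 0)) :=
        tendsto_one_div_add_atTop_nhds_zero_nat.const_add _
      simpa only [add_zero, Complex.ofReal_one, Function.comp_def] using
        (Complex.continuous_ofReal.tendsto _).comp h1
    · have : 1 / ((n : ℝ) + 1) ≠ 0 := by positivity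
      rw [mem_compl_iff, mem_singleton_iff, ← Complex.ofReal_one, Complex.ofReal_inj]
      simpa using this
  refine hseq.frequently (Eventually.of_forall fun n => ?_).frequently
  exact integral_exp_neg_mul_add_cpow_of_pos (by positivity) hL k

theorem image_mul_exp_neg_Ioi {b : ℝ} (hb : 0 < b) :
    (fun u : ℝ => b * Real.exp (-u)) '' Ioi 0 = Ioo 0 b := by
  ext x
  constructor
  · rintro ⟨u, hu, rfl⟩
    have hu : 0 < u := hu
    refine ⟨by positivity, mul_lt_of_lt_one_right hb ?_⟩
    rw [Real.exp_lt_one_iff]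
    linarith
  · rintro ⟨hx0, hxb⟩
    refine ⟨-Real.log (x / b), ?_, ?_⟩
    · have := Real.log_neg (div_pos hx0 hb) ((div_lt_one hb).2 hxb)
      simpa using this
    · simp only [neg_neg]
      rw [Real.exp_log (div_pos hx0 hb)]
      field_simp

theorem injOn_mul_exp_neg {b : ℝ} (hb : 0 < b) (S : Set ℝ) :
    InjOn (fun u : ℝ => b * Real.exp (-u)) S := by
  intro x _ y _ h
  simpa [hb.ne'] using h

theorem hasDerivWithinAt_mul_exp_neg (b u : ℝ) (S : Set ℝ) :
    HasDerivWithinAt (fun u : ℝ => b * Real.exp (-u)) (-(b * Real.exp (-u))) S u := by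
  have := ((hasDerivAt_neg u).exp.const_mul b).hasDerivWithinAt (s := S)
  simpa using this

theorem abs_deriv_smul_cpow_mul_neg_log_cpow {a b : ℝ} (ha : 0 < a) (hb : 0 < b) (w k : ℂ)
    (u : ℝ) :
    |-(b * Real.exp (-u))| • (((b * Real.exp (-u) : ℝ) : ℂ) ^ w
        * (-(Complex.log ((a : ℂ) * ((b * Real.exp (-u) : ℝ) : ℂ)))) ^ k)
      = (b : ℂ) ^ (w + 1) * (Complex.exp (-(w + 1) * u)
        * ((u : ℂ) + ((-Real.log (a * b) : ℝ) : ℂ)) ^ k) := by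
  have hx : 0 < b * Real.exp (-u) := by positivity
  have hx' : ((b * Real.exp (-u) : ℝ) : ℂ) ≠ 0 := by exact_mod_cast hx.ne'
  have hb' : (b : ℂ) ≠ 0 := by exact_mod_cast hb.ne'
  have hlog : -(Complex.log ((a : ℂ) * ((b * Real.exp (-u) : ℝ) : ℂ)))
      = (u : ℂ) + ((-Real.log (a * b) : ℝ) : ℂ) := by
    rw [← Complex.ofReal_mul, ← Complex.ofReal_log (by positivity), ← mul_assoc,
      Real.log_mul (by positivity) (by positivity), Real.log_exp]
    push_cast
    ring
  have hpow : ((b * Real.exp (-u) : ℝ) : ℂ) * ((b * Real.exp (-u) : ℝ) : ℂ) ^ w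
      = (b : ℂ) ^ (w + 1) * Complex.exp (-(w + 1) * u) := by
    have hadd := Complex.cpow_add w 1 hx'
    rw [Complex.cpow_one] at hadd
    rw [mul_comm, ← hadd, Complex.cpow_def_of_ne_zero hx',
      Complex.cpow_def_of_ne_zero hb', ← Complex.exp_add, ← Complex.ofReal_log hx.le,
      ← Complex.ofReal_log hb.le, Real.log_mul (by positivity) (by positivity), Real.log_exp]
    congr 1
    push_cast
    ring
  rw [hlog, abs_neg, abs_of_pos hx, Complex.real_smul, ← mul_assoc, hpow, mul_assoc]

theorem integrableOn_exp_neg_mul_mul_add_cpow {L : ℝ} (hL : 0 < L) {c k : ℂ} (hc : 0 < c.re)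
    (hk : 0 < k.re) :
    IntegrableOn (fun t : ℝ => Complex.exp (-c * t) * ((t : ℂ) + L) ^ k) (Ioi 0) := by
  refine Integrable.mono' ((integrableOn_exp_neg_mul_mul_add_rpow hc hL hk).mul_const
    (Real.exp (Real.pi * |k.im|)))
    ((continuousOn_exp_neg_mul_mul_add_cpow (by simpa using hL) _ _).aestronglyMeasurable
      measurableSet_Ioi) ?_
  filter_upwards [ae_restrict_mem measurableSet_Ioi] with t ht
  exact norm_exp_neg_mul_mul_add_cpow_le hk _ _ ht le_rfl
    (by rw [Complex.norm_real, Real.norm_of_nonneg hL.le])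

theorem integrableOn_cpow_mul_neg_log_cpow {a b : ℝ} (ha : 0 < a) (hb : 0 < b) (hab : a * b < 1)
    {w k : ℂ} (hw : -1 < w.re) (hk : 0 < k.re) :
    IntegrableOn (fun x : ℝ => (x : ℂ) ^ w * (-(Complex.log ((a : ℂ) * (x : ℂ)))) ^ k)
      (Ioo 0 b) := by
  rw [← image_mul_exp_neg_Ioi hb, integrableOn_image_iff_integrableOn_abs_deriv_smul
    measurableSet_Ioi (fun u _ => hasDerivWithinAt_mul_exp_neg b u _) (injOn_mul_exp_neg hb _)]
  simp only [abs_deriv_smul_cpow_mul_neg_log_cpow ha hb]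
  refine (integrableOn_exp_neg_mul_mul_add_cpow ?_ ?_ hk).const_mul _
  · linarith [Real.log_neg (mul_pos ha hb) hab]
  · simp only [Complex.add_re, Complex.one_re]
    linarith

theorem integral_cpow_mul_neg_log_cpow {a b : ℝ} (ha : 0 < a) (hb : 0 < b) (hab : a * b < 1)
    {w k : ℂ} (hw : -1 < w.re) (hk : 0 < k.re) :
    ∫ x in Ioo 0 b, (x : ℂ) ^ w * (-(Complex.log ((a : ℂ) * (x : ℂ)))) ^ k
      = (a : ℂ)⁻¹ * (uGamma (1 + k) (-((1 + w) * Complex.log ((a : ℂ) * (b : ℂ))))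
        / ((a : ℂ) ^ w * (1 + w) ^ (k + 1))) := by
  have hL : 0 < -Real.log (a * b) := by linarith [Real.log_neg (mul_pos ha hb) hab]
  have hc : 0 < (1 + w).re := by
    simp only [Complex.add_re, Complex.one_re]
    linarith
  have hc0 : 1 + w ≠ 0 := fun h => by simp [h] at hc
  have ha' : (a : ℂ) ≠ 0 := by exact_mod_cast ha.ne'
  have haw : (a : ℂ) ^ w ≠ 0 := by simp [Complex.cpow_eq_zero_iff, ha']
  have hcw : (1 + w) ^ (k + 1) ≠ 0 := by simp [Complex.cpow_eq_zero_iff, hc0]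
  have hz : -((1 + w) * Complex.log ((a : ℂ) * (b : ℂ)))
      = (1 + w) * ((-Real.log (a * b) : ℝ) : ℂ) := by
    rw [← Complex.ofReal_mul, ← Complex.ofReal_log (by positivity)]
    push_cast
    ring
  have hexp : Complex.exp (-((1 + w) * ((-Real.log (a * b) : ℝ) : ℂ)))
      = (a : ℂ) * (a : ℂ) ^ w * (b : ℂ) ^ (w + 1) := by
    have hadd := Complex.cpow_add w 1 ha'
    rw [Complex.cpow_one] at hadd
    rw [mul_comm (a : ℂ), ← hadd, ← Complex.mul_cpow_ofReal_nonneg ha.le hb.le,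
      Complex.cpow_def_of_ne_zero (by exact_mod_cast (mul_pos ha hb).ne'), ← Complex.ofReal_mul,
      ← Complex.ofReal_log (by positivity)]
    congr 1
    push_cast
    ring
  rw [← image_mul_exp_neg_Ioi hb, integral_image_eq_integral_abs_deriv_smul
    measurableSet_Ioi (fun u _ => hasDerivWithinAt_mul_exp_neg b u _) (injOn_mul_exp_neg hb _)]
  simp only [abs_deriv_smul_cpow_mul_neg_log_cpow ha hb]
  rw [integral_const_mul, uGamma, hz, hexp, add_sub_cancel_left,
    integral_exp_neg_mul_add_cpow hL hk hc, add_comm w 1]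
  field_simp

theorem summable_pow_div_natCast_add_cpow {r : ℝ} (hr0 : 0 ≤ r) (hr1 : r < 1) {v : ℂ}
    (hv : 0 < v.re) (s : ℂ) : Summable fun n : ℕ => r ^ n / ‖((n : ℂ) + v) ^ s‖ := by
  obtain ⟨N, hN⟩ := exists_nat_ge (-s.re)
  have hO : (fun n : ℕ => ‖((n : ℂ) + v) ^ s‖⁻¹) =O[atTop] fun n : ℕ => ((n ^ N : ℕ) : ℝ) := by
    refine Asymptotics.IsBigO.of_bound (2 ^ N * Real.exp (Real.pi * |s.im|)) ?_
    filter_upwards [eventually_ge_atTop 1, eventually_ge_atTop ⌈‖v‖⌉₊] with n hn1 hnv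
    have hn1 : (1 : ℝ) ≤ n := by exact_mod_cast hn1
    have hnv : ‖v‖ ≤ n := Nat.ceil_le.1 hnv
    have hlow : 1 ≤ ‖(n : ℂ) + v‖ := by
      refine le_trans ?_ (Complex.re_le_norm _)
      simp only [Complex.add_re, Complex.natCast_re]
      linarith
    have hupp : ‖(n : ℂ) + v‖ ≤ 2 * n := by
      refine (norm_add_le _ _).trans ?_
      rw [Complex.norm_natCast]
      linarith
    rw [← norm_inv, ← Complex.cpow_neg, norm_norm, Real.norm_of_nonneg (by positivity)]
    calc ‖((n : ℂ) + v) ^ (-s)‖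
        ≤ ‖(n : ℂ) + v‖ ^ (-s.re) * Real.exp (Real.pi * |s.im|) := by
          simpa using Complex.norm_cpow_le_exp_pi_mul ((n : ℂ) + v) (-s)
      _ ≤ ‖(n : ℂ) + v‖ ^ (N : ℝ) * Real.exp (Real.pi * |s.im|) := by gcongr
      _ ≤ (2 * n) ^ N * Real.exp (Real.pi * |s.im|) := by
          rw [Real.rpow_natCast]
          gcongr
      _ = _ := by push_cast; ring
  have hO' : (fun n : ℕ => r ^ n / ‖((n : ℂ) + v) ^ s‖)
      =O[atTop] fun n : ℕ => ((n : ℝ) ^ N * r ^ n) := by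
    simp only [div_eq_inv_mul]
    exact (by simpa using hO : _ =O[atTop] fun n : ℕ => (n : ℝ) ^ N).mul
      (Asymptotics.isBigO_refl _ _)
  exact summable_of_isBigO_nat
    (summable_pow_mul_geometric_of_norm_lt_one N (by rwa [Real.norm_of_nonneg hr0])) hO'

theorem stmt15 (a b : ℝ) (hb0 : 0 < b) (hb1 : b < 1) (ha : 0 < a) (hab : a * b < 1)
    (m s v k : ℂ) (hm : -1 < m.re) (hv : 0 < v.re) (hk : 0 < k.re) :
    (∫ x in (0:ℝ)..b, (x:ℂ) ^ m * lerchPhi (x:ℂ) s v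
        * (-(Complex.log ((a:ℂ) * (x:ℂ)))) ^ k)
    = (a:ℂ)⁻¹ * ∑' l : ℕ,
        uGamma (1 + k) (-((1 + (l:ℂ) + m) * Complex.log ((a:ℂ) * (b:ℂ))))
          / ((a:ℂ) ^ ((l:ℂ) + m) * (1 + (l:ℂ) + m) ^ (k + 1) * ((l:ℂ) + v) ^ s) := by
  have hterm : ∀ n : ℕ, EqOn (fun x : ℝ => (x : ℂ) ^ m * ((x : ℂ) ^ n / ((n : ℂ) + v) ^ s)
      * (-(Complex.log ((a : ℂ) * (x : ℂ)))) ^ k)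
      (fun x : ℝ => (((n : ℂ) + v) ^ s)⁻¹ * ((x : ℂ) ^ ((n : ℂ) + m)
        * (-(Complex.log ((a : ℂ) * (x : ℂ)))) ^ k)) (Ioo 0 b) := by
    intro n x hx
    have hx0 : (x : ℂ) ≠ 0 := by exact_mod_cast hx.1.ne'
    simp only [Complex.cpow_add _ _ hx0, Complex.cpow_natCast]
    ring
  have hre : ∀ n : ℕ, -1 < ((n : ℂ) + m).re := fun n => by
    simp only [Complex.add_re, Complex.natCast_re]
    linarith [n.cast_nonneg (α := ℝ)]
  have hint : ∀ n : ℕ, IntegrableOn (fun x : ℝ => (x : ℂ) ^ m * ((x : ℂ) ^ n / ((n : ℂ) + v) ^ s)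
      * (-(Complex.log ((a : ℂ) * (x : ℂ)))) ^ k) (Ioo 0 b) := fun n =>
    IntegrableOn.congr_fun
      (Integrable.const_mul (integrableOn_cpow_mul_neg_log_cpow ha hb0 hab (hre n) hk) _)
      (hterm n).symm measurableSet_Ioo
  have hg := integrableOn_cpow_mul_neg_log_cpow ha hb0 hab hm hk
  have hsum : Summable fun n : ℕ => ∫ x in Ioo 0 b, ‖(x : ℂ) ^ m
      * ((x : ℂ) ^ n / ((n : ℂ) + v) ^ s) * (-(Complex.log ((a : ℂ) * (x : ℂ)))) ^ k‖ := by
    refine Summable.of_nonneg_of_le (fun n => integral_nonneg fun x => norm_nonneg _) (fun n => ?_)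
      ((summable_pow_div_natCast_add_cpow hb0.le hb1 hv s).mul_right
        (∫ x in Ioo 0 b, ‖(x : ℂ) ^ m * (-(Complex.log ((a : ℂ) * (x : ℂ)))) ^ k‖))
    rw [← integral_const_mul]
    refine setIntegral_mono_on (hint n).norm (hg.norm.const_mul _) measurableSet_Ioo
      fun x hx => ?_
    rw [mul_right_comm, norm_mul, mul_comm, norm_div, norm_pow, Complex.norm_real,
      Real.norm_of_nonneg hx.1.le]
    have := hx.1.le
    have := hx.2.le
    gcongr
  rw [intervalIntegral.integral_of_le hb0.le, integral_Ioc_eq_integral_Ioo]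
  calc ∫ x in Ioo 0 b, (x : ℂ) ^ m * lerchPhi (x : ℂ) s v
        * (-(Complex.log ((a : ℂ) * (x : ℂ)))) ^ k
      = ∫ x in Ioo 0 b, ∑' n : ℕ, (x : ℂ) ^ m * ((x : ℂ) ^ n / ((n : ℂ) + v) ^ s)
        * (-(Complex.log ((a : ℂ) * (x : ℂ)))) ^ k := by
        simp only [lerchPhi, tsum_mul_left, tsum_mul_right]
    _ = ∑' n : ℕ, ∫ x in Ioo 0 b, (x : ℂ) ^ m * ((x : ℂ) ^ n / ((n : ℂ) + v) ^ s)
        * (-(Complex.log ((a : ℂ) * (x : ℂ)))) ^ k :=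
        (integral_tsum_of_summable_integral_norm hint hsum).symm
    _ = _ := by
        rw [← tsum_mul_left]
        refine tsum_congr fun n => ?_
        rw [setIntegral_congr_fun measurableSet_Ioo (hterm n), integral_const_mul,
          integral_cpow_mul_neg_log_cpow ha hb0 hab (hre n) hk, add_assoc]
        simp only [div_eq_mul_inv, mul_inv]
        ring
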